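/- Let (C, D, E, i_*, j^*, i^*, i^!, j_!, j_*) be gluing data endowed with compatible t-structures t_C, t_D, t_E. Then for any X', Y' ∈ E^{t_E=0}, the map Hom_C(j_{!*}X', j_{!*}Y') → Hom_E(X', Y') induced by j^* (using the isomorphisms j^*j_{!*}X' ≅ X' and j^*j_{!*}Y' ≅ Y') is bijective; i.e., j_{!*} is a fully faithful functor from the heart of t_E to the heart of t_C. -/

import Mathlib

namespace PaperGluing

open CategoryTheory CategoryTheory.Limits CategoryTheory.Pretriangulated CategoryTheory.Triangulated

universe v v₂ v₃ v₄ u u₂ u₃ u₄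

section Generic

variable (A : Type u₄) [Category.{v₄} A] [HasZeroObject A] [Preadditive A] [HasShift A ℤ]
  [∀ n : ℤ, (shiftFunctor A n).Additive] [Pretriangulated A]

/-- The class `A^{t=0}` of a `t`-structure. -/
def heartSet (t : TStructure A) : Set A := fun X => t.le 0 X ∧ t.ge 0 X

/-- The heart of a `t`-structure, as a full subcategory. -/
abbrev THeart (t : TStructure A) := ObjectProperty.FullSubcategory (fun X : A => X ∈ heartSet A t)

/-- The inclusion of the heart. -/
abbrev heartIncl (t : TStructure A) : THeart A t ⥤ A :=
  ObjectProperty.ι (fun X : A => X ∈ heartSet A t)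

/-- Truncation data for a `t`-structure `t` (such data always exists):
functors `τ_{≤0}`, `τ_{≥0}` with their universal properties. -/
structure TruncData (t : TStructure A) where
  truncLE : A ⥤ A
  truncGE : A ⥤ A
  εLE : truncLE ⟶ 𝟭 A
  ηGE : 𝟭 A ⟶ truncGE
  mem_le : ∀ X : A, t.le 0 (truncLE.obj X)
  mem_ge : ∀ X : A, t.ge 0 (truncGE.obj X)
  le_univ : ∀ (W X : A), t.le 0 W →
    Function.Bijective (fun f : W ⟶ truncLE.obj X => f ≫ εLE.app X)
  ge_univ : ∀ (X W : A), t.ge 0 W →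
    Function.Bijective (fun f : truncGE.obj X ⟶ W => ηGE.app X ≫ f)
  mem_heart : ∀ X : A, truncGE.obj (truncLE.obj X) ∈ heartSet A t
  isoHeart : ∀ X : A, X ∈ heartSet A t → (truncGE.obj (truncLE.obj X) ≅ X)

variable {A}

/-- The zeroth homology functor `H^t_0 : A ⥤ Ht`. -/
def TruncData.H₀ {t : TStructure A} (τ : TruncData A t) : A ⥤ THeart A t :=
  ObjectProperty.lift _ (τ.truncLE ⋙ τ.truncGE) (fun X => τ.mem_heart X)

end Generic

variable {C : Type u} {D : Type u₂} {E : Type u₃}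
  [Category.{v} C] [Category.{v₂} D] [Category.{v₃} E]
  [HasZeroObject C] [HasZeroObject D] [HasZeroObject E]
  [Preadditive C] [Preadditive D] [Preadditive E]
  [HasShift C ℤ] [HasShift D ℤ] [HasShift E ℤ]
  [∀ n : ℤ, (shiftFunctor C n).Additive] [∀ n : ℤ, (shiftFunctor D n).Additive]
  [∀ n : ℤ, (shiftFunctor E n).Additive]
  [Pretriangulated C] [Pretriangulated D] [Pretriangulated E]

/-- The conditions, beyond the exactness of the six functors and the four
adjunctions, making `(C, D, E, i_*, j^*, i^*, i^!, j_!, j_*)` into gluing data: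
`i_*` is a full embedding, `j^*` is the localization of `C` by `i_*(D)` (its
kernel is the essential image of `i_*`), the two adjunction triangles are
distinguished, `i^* j_! = 0`, `i^! j_* = 0`, and the four adjunction
transformations `i^* i_* → id → i^! i_*`, `j^* j_* → id → j^* j_!` are
isomorphisms. -/
structure GluingCond (iS : D ⥤ C) (jU : C ⥤ E) (iU iE : C ⥤ D) (jL jR : E ⥤ C)
    (adj₁ : iU ⊣ iS) (adj₂ : iS ⊣ iE) (adj₃ : jL ⊣ jU) (adj₄ : jU ⊣ jR) :
    Prop where
  full_iS : iS.Full
  faithful_iS : iS.Faithful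
  ker_jU : ∀ X : C, IsZero (jU.obj X) ↔ ∃ Y : D, Nonempty (iS.obj Y ≅ X)
  tri₁ : ∀ X : C, ∃ δ : iS.obj (iU.obj X) ⟶ (jL.obj (jU.obj X))⟦(1 : ℤ)⟧,
    Triangle.mk (adj₃.counit.app X) (adj₁.unit.app X) δ ∈ distTriang C
  tri₂ : ∀ X : C, ∃ δ : jR.obj (jU.obj X) ⟶ (iS.obj (iE.obj X))⟦(1 : ℤ)⟧,
    Triangle.mk (adj₂.counit.app X) (adj₄.unit.app X) δ ∈ distTriang C
  vanish₁ : ∀ Y : E, IsZero (iU.obj (jL.obj Y))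
  vanish₂ : ∀ Y : E, IsZero (iE.obj (jR.obj Y))
  iso₁ : ∀ Y : D, IsIso (adj₁.counit.app Y)
  iso₂ : ∀ Y : D, IsIso (adj₂.unit.app Y)
  iso₃ : ∀ X : E, IsIso (adj₃.unit.app X)
  iso₄ : ∀ X : E, IsIso (adj₄.counit.app X)

/-- The `t`-structure `tC` is glued from `tD` and `tE` (the three t-structures
are then called compatible). -/
def GluedTS (jU : C ⥤ E) (iU iE : C ⥤ D)
    (tC : TStructure C) (tD : TStructure D) (tE : TStructure E) : Prop :=
  ∀ X : C, (tC.le 0 X ↔ (tE.le 0 (jU.obj X) ∧ tD.le 0 (iU.obj X))) ∧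
    (tC.ge 0 X ↔ (tE.ge 0 (jU.obj X) ∧ tD.ge 0 (iE.obj X)))

/-- The intermediate image `j_{!*}X'` of an object `X'` of the heart of `tE`:
the image of `H^{t_C}_0(j_! X') ⟶ H^{t_C}_0(j_* X')`, where the morphism
`j_! X' ⟶ j_* X'` is obtained from the adjunctions via `j^* j_! ≅ id ≅ j^* j_*`. -/
noncomputable def jMiddle (jU : C ⥤ E) (jL jR : E ⥤ C)
    (adj₃ : jL ⊣ jU) (adj₄ : jU ⊣ jR)
    (hiso : ∀ Y : E, IsIso (adj₃.unit.app Y))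
    {tC : TStructure C} (τC : TruncData C tC) [HasImages (THeart C tC)]
    {tE : TStructure E} (X' : THeart E tE) : THeart C tC :=
  haveI := hiso X'.obj
  image (τC.H₀.map
    ((adj₄.homEquiv (jL.obj X'.obj) X'.obj) (inv (adj₃.unit.app X'.obj))))

section Helpers

section T
variable {A : Type u₄} [Category.{v₄} A] [HasZeroObject A] [Preadditive A] [HasShift A ℤ]
  [∀ n : ℤ, (shiftFunctor A n).Additive] [Pretriangulated A]

theorem aux_hom_ge_zero (t : TStructure A) {P : A} (hP0 : t.le 0 P)
    (hP : ∀ W : A, W ∈ heartSet A t → ∀ f : P ⟶ W, f = 0)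
    {W : A} (hW : t.ge 0 W) (f : P ⟶ W) : f = 0 := by
  have : t.IsLE P 0 := ⟨hP0⟩
  have : t.IsGE W 0 := ⟨hW⟩
  have hT : (t.truncLE 0).obj W ∈ heartSet A t := by
    refine ⟨t.le_of_isLE _ 0, ?_⟩
    rw [t.ge_iff_isGE, t.isGE_iff_orthogonal (-1) 0 (by norm_num)]
    intro V g hV
    have := hV
    have : t.IsLE V 0 := t.isLE_of_le V (-1) 0
    apply t.to_truncLE_obj_ext
    rw [zero_comp]
    exact t.zero_of_isLE_of_isGE (Y := W) _ (-1) 0 (by norm_num) hV inferInstance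
  rw [← t.liftTruncLE_ι f 0, hP _ hT (t.liftTruncLE f 0), zero_comp]

theorem aux_hom_shift_zero (t : TStructure A) {P Q : A} (hP0 : t.le 0 P)
    (hP : ∀ W : A, W ∈ heartSet A t → ∀ f : P ⟶ W, f = 0)
    (hQ0 : t.ge 0 Q)
    (hQ : ∀ W : A, W ∈ heartSet A t → ∀ f : W ⟶ Q, f = 0)
    (f : P ⟶ Q⟦(1 : ℤ)⟧) : f = 0 := by
  have : t.IsGE Q 0 := ⟨hQ0⟩
  obtain ⟨X, Y, hX, hY, a, b, c, hT⟩ := t.exists_triangle_zero_one Q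
  have : t.IsLE X 0 := ⟨hX⟩
  have : t.IsGE Y 1 := ⟨hY⟩
  have hXh : X ∈ heartSet A t := by
    refine ⟨hX, ?_⟩
    rw [t.ge_iff_isGE]
    have : t.IsGE (Y⟦(-1 : ℤ)⟧) 2 := t.isGE_shift Y 1 (-1) 2
    exact t.isGE₂ _ (inv_rot_of_distTriang _ hT) 0
      (t.isGE_of_ge (Y⟦(-1 : ℤ)⟧) 0 2) (show t.IsGE Q 0 by infer_instance)
  have ha : a = 0 := hQ X hXh a
  have h1 : f ≫ b⟦(1 : ℤ)⟧' = 0 :=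
    aux_hom_ge_zero t hP0 hP (t.ge_shift 1 1 0 (by norm_num) Y hY) _
  obtain ⟨g, hg⟩ := Triangle.coyoneda_exact₁ _ (rot_of_distTriang _ hT) f h1
  have : f = g ≫ (-(a⟦(1 : ℤ)⟧')) := hg
  rw [this, ha, Functor.map_zero, neg_zero]
  exact comp_zero

variable {t : TStructure A}

theorem aux_eps_iso (τ : TruncData A t) {Z : A} (hZ : t.le 0 Z) : IsIso (τ.εLE.app Z) := by
  obtain ⟨s, hs⟩ := (τ.le_univ Z Z hZ).2 (𝟙 Z)
  refine ⟨s, ?_, hs⟩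
  apply (τ.le_univ _ Z (τ.mem_le Z)).1
  change s ≫ τ.εLE.app Z = 𝟙 Z at hs
  change (τ.εLE.app Z ≫ s) ≫ τ.εLE.app Z = 𝟙 _ ≫ τ.εLE.app Z
  rw [Category.assoc, hs]
  simp

theorem aux_eta_iso (τ : TruncData A t) {Z : A} (hZ : t.ge 0 Z) : IsIso (τ.ηGE.app Z) := by
  obtain ⟨s, hs⟩ := (τ.ge_univ Z Z hZ).2 (𝟙 Z)
  refine ⟨s, hs, ?_⟩
  apply (τ.ge_univ Z _ (τ.mem_ge Z)).1
  change τ.ηGE.app Z ≫ s = 𝟙 Z at hs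
  change τ.ηGE.app Z ≫ (s ≫ τ.ηGE.app Z) = τ.ηGE.app Z ≫ 𝟙 _
  rw [← Category.assoc, hs]
  simp

theorem aux_truncLE_ge (τ : TruncData A t) {Z : A} (hZ : t.ge 0 Z) : t.ge 0 (τ.truncLE.obj Z) := by
  have : t.IsGE Z 0 := ⟨hZ⟩
  rw [t.ge_iff_isGE, t.isGE_iff_orthogonal (-1) 0 (by norm_num)]
  intro V g hV
  have := hV
  have : t.IsLE V 0 := t.isLE_of_le V (-1) 0
  apply (τ.le_univ V Z (t.le_of_isLE V 0)).1
  change g ≫ τ.εLE.app Z = 0 ≫ τ.εLE.app Z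
  rw [zero_comp]
  exact t.zero_of_isLE_of_isGE (Y := Z) _ (-1) 0 (by norm_num) hV inferInstance

theorem aux_truncGE_le (τ : TruncData A t) {Z : A} (hZ : t.le 0 Z) : t.le 0 (τ.truncGE.obj Z) := by
  have : t.IsLE Z 0 := ⟨hZ⟩
  rw [t.le_iff_isLE, t.isLE_iff_orthogonal 0 1 (by norm_num)]
  intro V g hV
  have := hV
  have : t.IsGE V 0 := t.isGE_of_ge V 0 1
  apply (τ.ge_univ Z V (t.ge_of_isGE V 0)).1
  change τ.ηGE.app Z ≫ g = τ.ηGE.app Z ≫ 0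
  rw [comp_zero]
  exact t.zero_of_isLE_of_isGE (X := Z) _ 0 1 (by norm_num) inferInstance hV

/-- monomorphisms of the heart cancel against all sources `≤ 0`. -/
theorem aux_mono (τ : TruncData A t) {I B : THeart A t} (m : I ⟶ B) [Mono m] {V : A} (hV : t.le 0 V)
    (g : V ⟶ I.obj) (hg : g ≫ m.hom = 0) : g = 0 := by
  obtain ⟨g', hg'⟩ := (τ.ge_univ V I.obj I.property.2).2 g
  change τ.ηGE.app V ≫ g' = g at hg'
  have h0 : g' ≫ m.hom = 0 := by
    apply (τ.ge_univ V B.obj B.property.2).1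
    change τ.ηGE.app V ≫ (g' ≫ m.hom) = τ.ηGE.app V ≫ 0
    rw [← Category.assoc, hg', hg, comp_zero]
  let K : THeart A t := ⟨τ.truncGE.obj V, aux_truncGE_le τ hV, τ.mem_ge V⟩
  let k : K ⟶ I := ObjectProperty.homMk g'
  let z : K ⟶ I := ObjectProperty.homMk 0
  have hk : k = z := by
    rw [← cancel_mono m]
    ext
    change g' ≫ m.hom = 0 ≫ m.hom
    rw [h0, zero_comp]
  have : g' = 0 := congrArg (fun u : K ⟶ I => u.hom) hk
  rw [← hg', this, comp_zero]

theorem aux_epi (τ : TruncData A t) [HasImages (THeart A t)] {M N : THeart A t} (f : M ⟶ N) {Z : A}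
    (hZ : Z ∈ heartSet A t) (g : (image f).obj ⟶ Z)
    (hg : (factorThruImage f).hom ≫ g = 0) : g = 0 := by
  obtain ⟨K, k, d, hT⟩ := distinguished_cocone_triangle₁ g
  have : t.IsGE Z 0 := ⟨hZ.2⟩
  have : t.IsGE (Z⟦(-1 : ℤ)⟧) 1 := t.isGE_shift Z 0 (-1) 1
  have : t.IsGE (Z⟦(-1 : ℤ)⟧) 0 := t.isGE_of_ge _ 0 1
  have : t.IsGE (image f).obj 0 := ⟨(image f).property.2⟩
  have hK : t.IsGE K 0 := t.isGE₂ _ (inv_rot_of_distTriang _ hT) 0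
      (show t.IsGE (Z⟦(-1 : ℤ)⟧) 0 by infer_instance) (show t.IsGE (image f).obj 0 by infer_instance)
  have hkg : k ≫ g = 0 := comp_distTriang_mor_zero₁₂ _ hT
  let T : THeart A t := ⟨τ.truncLE.obj K, τ.mem_le K, aux_truncLE_ge τ hK.ge⟩
  let κ : T ⟶ image f := ObjectProperty.homMk (τ.εLE.app K ≫ k)
  -- `κ` is a monomorphism
  have hcanc : ∀ (V : A), t.le 0 V → ∀ u : V ⟶ τ.truncLE.obj K,
      u ≫ τ.εLE.app K ≫ k = 0 → u = 0 := by
    intro V hV u hu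
    have : t.IsLE V 0 := ⟨hV⟩
    apply (τ.le_univ V K hV).1
    change u ≫ τ.εLE.app K = 0 ≫ τ.εLE.app K
    rw [zero_comp]
    obtain ⟨w, hw⟩ := Triangle.coyoneda_exact₂ _ (inv_rot_of_distTriang _ hT)
      (u ≫ τ.εLE.app K) (by change (u ≫ τ.εLE.app K) ≫ k = 0; rw [Category.assoc, hu])
    have hw0 : w = 0 := t.zero_of_isLE_of_isGE w 0 1 (by norm_num) inferInstance
      (show t.IsGE (Z⟦(-1 : ℤ)⟧) 1 by infer_instance)
    refine hw.trans ?_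
    rw [hw0]
    exact zero_comp
  have : Mono κ := by
    refine ⟨fun {V} a b hab => ?_⟩
    ext
    rw [← sub_eq_zero]
    apply hcanc V.obj V.property.1
    rw [Preadditive.sub_comp, sub_eq_zero]
    exact congrArg (fun u : V ⟶ image f => u.hom) hab
  -- factor
  obtain ⟨r, hr⟩ := Triangle.coyoneda_exact₂ _ hT (factorThruImage f).hom hg
  change (factorThruImage f).hom = r ≫ k at hr
  obtain ⟨s, hs⟩ := (τ.le_univ M.obj K M.property.1).2 r
  change s ≫ τ.εLE.app K = r at hs
  let e' : M ⟶ T := ObjectProperty.homMk s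
  have he' : e' ≫ κ = factorThruImage f := by
    ext
    change s ≫ τ.εLE.app K ≫ k = _
    rw [← Category.assoc, hs]
    exact hr.symm
  let F : MonoFactorisation f :=
    { I := T, m := κ ≫ image.ι f, e := e',
      fac := by rw [← Category.assoc, he', image.fac] }
  have h1 : image.lift F ≫ κ = 𝟙 (image f) := by
    rw [← cancel_mono (image.ι f), Category.assoc, Category.id_comp]
    exact image.lift_fac F
  have h2 : (image.lift F).hom ≫ (τ.εLE.app K ≫ k) = 𝟙 (image f).obj :=
    congrArg (fun u : image f ⟶ image f => u.hom) h1
  calc g = 𝟙 _ ≫ g := (Category.id_comp g).symm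
    _ = 0 := by rw [← h2]; simp [hkg]

end T

variable {iS : D ⥤ C} {jU : C ⥤ E} {iU iE : C ⥤ D} {jL jR : E ⥤ C}
    {adj₁ : iU ⊣ iS} {adj₂ : iS ⊣ iE} {adj₃ : jL ⊣ jU} {adj₄ : jU ⊣ jR}

theorem aux_jL_le [iU.CommShift ℤ] [iU.IsTriangulated]
    (hg : GluingCond iS jU iU iE jL jR adj₁ adj₂ adj₃ adj₄)
    {tC : TStructure C} {tD : TStructure D} {tE : TStructure E}
    (hglued : GluedTS jU iU iE tC tD tE) {W : E} (hW : tE.le 0 W) : tC.le 0 (jL.obj W) := by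
  have := hg.iso₃ W
  exact (hglued _).1.2 ⟨(tE.le 0).prop_of_iso (asIso (adj₃.unit.app W)) hW,
    (tD.isLE_of_isZero (hg.vanish₁ W) 0).le⟩

theorem aux_jR_ge
    (hg : GluingCond iS jU iU iE jL jR adj₁ adj₂ adj₃ adj₄)
    {tC : TStructure C} {tD : TStructure D} {tE : TStructure E}
    (hglued : GluedTS jU iU iE tC tD tE) {W : E} (hW : tE.ge 0 W) : tC.ge 0 (jR.obj W) := by
  have := hg.iso₄ W
  exact (hglued _).2.2 ⟨(tE.ge 0).prop_of_iso (asIso (adj₄.counit.app W)).symm hW,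
    (tD.isGE_of_isZero (hg.vanish₂ W) 0).ge⟩

theorem aux_jU_iS
    (hg : GluingCond iS jU iU iE jL jR adj₁ adj₂ adj₃ adj₄) (W : D) :
    IsZero (jU.obj (iS.obj W)) := (hg.ker_jU _).2 ⟨W, ⟨Iso.refl _⟩⟩

theorem aux_iS_heart
    (hg : GluingCond iS jU iU iE jL jR adj₁ adj₂ adj₃ adj₄)
    {tC : TStructure C} {tD : TStructure D} {tE : TStructure E}
    (hglued : GluedTS jU iU iE tC tD tE) {W : D} (hW : W ∈ heartSet D tD) :
    iS.obj W ∈ heartSet C tC := by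
  have := hg.iso₁ W
  have := hg.iso₂ W
  have h0 := aux_jU_iS hg W
  exact ⟨(hglued _).1.2 ⟨(tE.isLE_of_isZero h0 0).le,
      (tD.le 0).prop_of_iso (asIso (adj₁.counit.app W)).symm hW.1⟩,
    (hglued _).2.2 ⟨(tE.isGE_of_isZero h0 0).ge,
      (tD.ge 0).prop_of_iso (asIso (adj₂.unit.app W)) hW.2⟩⟩

/-- `j^*` of the truncation morphism `Z ⟶ τ_{≥0} Z` is an isomorphism if `j^* Z` is `≥ 0`. -/
theorem aux_jU_eta
    (hg : GluingCond iS jU iU iE jL jR adj₁ adj₂ adj₃ adj₄)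
    {tC : TStructure C} {tD : TStructure D} {tE : TStructure E}
    (hglued : GluedTS jU iU iE tC tD tE) (τC : TruncData C tC)
    {Z : C} (hZ : tE.ge 0 (jU.obj Z)) : IsIso (jU.map (τC.ηGE.app Z)) := by
  have key : ∀ W : E, tE.ge 0 W → Function.Bijective
      (fun f : jU.obj (τC.truncGE.obj Z) ⟶ W => jU.map (τC.ηGE.app Z) ≫ f) := by
    intro W hW
    have h := τC.ge_univ Z _ (aux_jR_ge hg hglued hW)
    constructor
    · intro a b hab
      apply (adj₄.homEquiv _ _).injective
      apply h.1
      change τC.ηGE.app Z ≫ _ = τC.ηGE.app Z ≫ _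
      change jU.map (τC.ηGE.app Z) ≫ a = jU.map (τC.ηGE.app Z) ≫ b at hab
      erw [← adj₄.homEquiv_naturality_left, ← adj₄.homEquiv_naturality_left, hab]
    · intro b
      obtain ⟨c, hc⟩ := h.2 (adj₄.homEquiv _ _ b)
      refine ⟨(adj₄.homEquiv _ _).symm c, ?_⟩
      apply (adj₄.homEquiv _ _).injective
      change adj₄.homEquiv _ _ (jU.map (τC.ηGE.app Z) ≫ _) = _
      erw [adj₄.homEquiv_naturality_left, Equiv.apply_symm_apply]
      exact hc
  obtain ⟨s, hs⟩ := (key _ hZ).2 (𝟙 _)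
  refine ⟨s, hs, ?_⟩
  apply (key _ ((hglued _).2.1 (τC.mem_ge Z)).1).1
  change jU.map (τC.ηGE.app Z) ≫ s = 𝟙 _ at hs
  change jU.map (τC.ηGE.app Z) ≫ (s ≫ jU.map (τC.ηGE.app Z)) = jU.map (τC.ηGE.app Z) ≫ 𝟙 _
  rw [← Category.assoc, hs, Category.comp_id]
  exact Category.id_comp _

theorem aux_jU_eps [iU.CommShift ℤ] [iU.IsTriangulated]
    (hg : GluingCond iS jU iU iE jL jR adj₁ adj₂ adj₃ adj₄)
    {tC : TStructure C} {tD : TStructure D} {tE : TStructure E}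
    (hglued : GluedTS jU iU iE tC tD tE) (τC : TruncData C tC)
    {Z : C} (hZ : tE.le 0 (jU.obj Z)) : IsIso (jU.map (τC.εLE.app Z)) := by
  have key : ∀ W : E, tE.le 0 W → Function.Bijective
      (fun f : W ⟶ jU.obj (τC.truncLE.obj Z) => f ≫ jU.map (τC.εLE.app Z)) := by
    intro W hW
    have h := τC.le_univ _ Z (aux_jL_le hg hglued hW)
    constructor
    · intro a b hab
      apply (adj₃.homEquiv _ _).symm.injective
      apply h.1
      change _ ≫ τC.εLE.app Z = _ ≫ τC.εLE.app Z
      change a ≫ jU.map (τC.εLE.app Z) = b ≫ jU.map (τC.εLE.app Z) at hab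
      erw [← adj₃.homEquiv_naturality_right_symm, ← adj₃.homEquiv_naturality_right_symm, hab]
    · intro b
      obtain ⟨c, hc⟩ := h.2 ((adj₃.homEquiv _ _).symm b)
      refine ⟨adj₃.homEquiv _ _ c, ?_⟩
      apply (adj₃.homEquiv _ _).symm.injective
      change (adj₃.homEquiv _ _).symm (_ ≫ jU.map (τC.εLE.app Z)) = _
      erw [adj₃.homEquiv_naturality_right_symm, Equiv.symm_apply_apply]
      exact hc
  obtain ⟨s, hs⟩ := (key _ hZ).2 (𝟙 _)
  refine ⟨s, ?_, hs⟩
  apply (key _ ((hglued _).1.1 (τC.mem_le Z)).1).1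
  change s ≫ jU.map (τC.εLE.app Z) = 𝟙 _ at hs
  change (jU.map (τC.εLE.app Z) ≫ s) ≫ jU.map (τC.εLE.app Z) = 𝟙 _ ≫ jU.map (τC.εLE.app Z)
  rw [Category.assoc, hs, Category.id_comp]
  exact Category.comp_id _

/-- The main properties of the intermediate image. -/
theorem aux_middle [iU.CommShift ℤ] [iU.IsTriangulated] [jU.CommShift ℤ] [jU.IsTriangulated]
    (hg : GluingCond iS jU iU iE jL jR adj₁ adj₂ adj₃ adj₄)
    {tC : TStructure C} {tD : TStructure D} {tE : TStructure E}
    (hglued : GluedTS jU iU iE tC tD tE) (τC : TruncData C tC) [HasImages (THeart C tC)]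
    (X' : THeart E tE) (u : jL.obj X'.obj ⟶ jR.obj X'.obj) (hu : IsIso (jU.map u)) :
    Nonempty (jU.obj (image (τC.H₀.map u)).obj ≅ X'.obj) ∧
    (∀ W : D, W ∈ heartSet D tD → ∀ f : (image (τC.H₀.map u)).obj ⟶ iS.obj W, f = 0) ∧
    (∀ W : D, W ∈ heartSet D tD → ∀ f : iS.obj W ⟶ (image (τC.H₀.map u)).obj, f = 0) := by
  have hL : tC.le 0 (jL.obj X'.obj) := aux_jL_le hg hglued X'.property.1
  have hR : tC.ge 0 (jR.obj X'.obj) := aux_jR_ge hg hglued X'.property.2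
  have := hg.iso₃ X'.obj
  have := hg.iso₄ X'.obj
  have hR' : tC.ge 0 (τC.truncLE.obj (jR.obj X'.obj)) := aux_truncLE_ge τC hR
  have i1 : IsIso (τC.εLE.app (jL.obj X'.obj)) := aux_eps_iso τC hL
  have i2 : IsIso (τC.ηGE.app (τC.truncLE.obj (jR.obj X'.obj))) := aux_eta_iso τC hR'
  have i3 : IsIso (jU.map (τC.εLE.app (jR.obj X'.obj))) := by
    refine aux_jU_eps hg hglued τC ?_
    exact (tE.le 0).prop_of_iso (asIso (adj₄.counit.app X'.obj)).symm X'.property.1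
  have i1' : IsIso (jU.map (τC.εLE.app (jL.obj X'.obj))) := inferInstance
  have e1 : jU.obj (τC.truncLE.obj (jL.obj X'.obj)) ≅ X'.obj :=
    asIso (jU.map (τC.εLE.app (jL.obj X'.obj))) ≪≫ (asIso (adj₃.unit.app X'.obj)).symm
  have i4 : IsIso (jU.map (τC.ηGE.app (τC.truncLE.obj (jL.obj X'.obj)))) :=
    aux_jU_eta hg hglued τC ((tE.ge 0).prop_of_iso e1.symm X'.property.2)
  have hf : IsIso (jU.map (τC.truncGE.map (τC.truncLE.map u))) := by
    have n1 : τC.truncLE.map u ≫ τC.εLE.app _ = τC.εLE.app _ ≫ u := τC.εLE.naturality u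
    have n2 : τC.truncLE.map u ≫ τC.ηGE.app _ =
      τC.ηGE.app _ ≫ τC.truncGE.map (τC.truncLE.map u) := τC.ηGE.naturality (τC.truncLE.map u)
    have m1 : jU.map (τC.truncLE.map u) ≫ jU.map (τC.εLE.app (jR.obj X'.obj)) =
        jU.map (τC.εLE.app _) ≫ jU.map u := by
      rw [← jU.map_comp, n1, jU.map_comp]
    have : IsIso (jU.map (τC.truncLE.map u) ≫ jU.map (τC.εLE.app (jR.obj X'.obj))) := by
      rw [m1]; exact IsIso.comp_isIso
    have : IsIso (jU.map (τC.truncLE.map u)) := IsIso.of_isIso_comp_right _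
      (jU.map (τC.εLE.app (jR.obj X'.obj)))
    have m2 : jU.map (τC.ηGE.app (τC.truncLE.obj (jL.obj X'.obj))) ≫
        jU.map (τC.truncGE.map (τC.truncLE.map u)) =
        jU.map (τC.truncLE.map u) ≫ jU.map (τC.ηGE.app _) := by
      rw [← jU.map_comp, ← n2, jU.map_comp]
    have : IsIso (jU.map (τC.ηGE.app (τC.truncLE.obj (jL.obj X'.obj))) ≫
        jU.map (τC.truncGE.map (τC.truncLE.map u))) := by
      rw [m2]; exact IsIso.comp_isIso
    exact IsIso.of_isIso_comp_left (jU.map (τC.ηGE.app (τC.truncLE.obj (jL.obj X'.obj)))) _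
  set f := τC.H₀.map u with hfdef
  obtain ⟨e₀, m₀, hepi, hmono, hfac₀⟩ :
      ∃ (e₀ : τC.truncGE.obj (τC.truncLE.obj (jL.obj X'.obj)) ⟶ (image f).obj)
        (m₀ : (image f).obj ⟶ τC.truncGE.obj (τC.truncLE.obj (jR.obj X'.obj))),
        (∀ Z : C, Z ∈ heartSet C tC → ∀ g : (image f).obj ⟶ Z, e₀ ≫ g = 0 → g = 0) ∧
        (∀ V : C, tC.le 0 V → ∀ g : V ⟶ (image f).obj, g ≫ m₀ = 0 → g = 0) ∧
        e₀ ≫ m₀ = τC.truncGE.map (τC.truncLE.map u) :=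
    ⟨(factorThruImage f).hom, (image.ι f).hom,
      fun Z hZ g h => aux_epi τC f hZ g h,
      fun V hV g h => aux_mono τC (image.ι f) hV g h,
      congrArg (fun v : τC.H₀.obj (jL.obj X'.obj) ⟶ τC.H₀.obj (jR.obj X'.obj) => v.hom)
        (image.fac f)⟩
  have hIle : tC.le 0 (image f).obj := (image f).property.1
  generalize (image f).obj = I at *
  have hfac : jU.map e₀ ≫ jU.map m₀ = jU.map (τC.truncGE.map (τC.truncLE.map u)) := by
    rw [← jU.map_comp, hfac₀]
  refine ⟨?_, ?_, ?_⟩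
  · -- `j^* (image.ι f)` is an isomorphism
    let q := inv (jU.map (τC.truncGE.map (τC.truncLE.map u))) ≫ jU.map e₀
    have hq : q ≫ jU.map m₀ = 𝟙 _ := by
      change (_ ≫ _) ≫ _ = _
      rw [Category.assoc, hfac]
      exact IsIso.inv_hom_id _
    have hle : tE.le 0 (jU.obj I) := ((hglued _).1.1 hIle).1
    have hcanc : ∀ v : jU.obj I ⟶ jU.obj I,
        v ≫ jU.map m₀ = 0 → v = 0 := by
      intro v hv
      apply (adj₃.homEquiv _ _).symm.injective
      have h0 : (adj₃.homEquiv (jU.obj I) I).symm v = 0 := by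
        apply hmono _ (aux_jL_le hg hglued hle)
        rw [← adj₃.homEquiv_naturality_right_symm, hv]
        apply (adj₃.homEquiv _ _).injective
        rw [Equiv.apply_symm_apply, adj₃.homEquiv_unit, jU.map_zero, comp_zero]
      rw [h0]
      apply (adj₃.homEquiv _ _).injective
      rw [Equiv.apply_symm_apply, adj₃.homEquiv_unit, jU.map_zero, comp_zero]
    have hq' : jU.map m₀ ≫ q = 𝟙 _ := by
      rw [← sub_eq_zero]
      apply hcanc
      rw [Preadditive.sub_comp, Category.assoc, hq, Category.id_comp]
      rw [Category.comp_id, sub_self]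
    have e2 : jU.obj I ≅ jU.obj (τC.truncGE.obj (τC.truncLE.obj (jR.obj X'.obj))) :=
      ⟨jU.map m₀, q, hq', hq⟩
    have e3 : jU.obj (τC.truncLE.obj (jR.obj X'.obj)) ≅
        jU.obj (τC.truncGE.obj (τC.truncLE.obj (jR.obj X'.obj))) :=
      jU.mapIso (asIso (τC.ηGE.app (τC.truncLE.obj (jR.obj X'.obj))))
    exact ⟨e2 ≪≫ e3.symm ≪≫ asIso (jU.map (τC.εLE.app (jR.obj X'.obj))) ≪≫
      asIso (adj₄.counit.app X'.obj)⟩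
  · intro W hW g
    have hWC := aux_iS_heart hg hglued hW
    apply hepi _ hWC g
    apply (τC.ge_univ (τC.truncLE.obj (jL.obj X'.obj)) (iS.obj W) hWC.2).1
    change τC.ηGE.app _ ≫ (e₀ ≫ g) = τC.ηGE.app _ ≫ 0
    rw [comp_zero, ← cancel_epi (inv (τC.εLE.app (jL.obj X'.obj)))]
    apply (adj₃.homEquiv _ _).injective
    exact (aux_jU_iS hg W).eq_of_tgt _ _
  · intro W hW g
    have hWC := aux_iS_heart hg hglued hW
    apply hmono _ hWC.1 g
    rw [← cancel_mono (inv (τC.ηGE.app (τC.truncLE.obj (jR.obj X'.obj))))]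
    apply (τC.le_univ (iS.obj W) (jR.obj X'.obj) hWC.1).1
    apply (adj₄.homEquiv _ _).symm.injective
    exact (aux_jU_iS hg W).eq_of_src _ _

theorem aux_full
    [iS.CommShift ℤ] [iU.CommShift ℤ] [iE.CommShift ℤ] [iS.IsTriangulated]
    (hg : GluingCond iS jU iU iE jL jR adj₁ adj₂ adj₃ adj₄)
    {tC : TStructure C} {tD : TStructure D} {tE : TStructure E}
    (hglued : GluedTS jU iU iE tC tD tE)
    (I J : THeart C tC)
    (hI : ∀ W : D, W ∈ heartSet D tD → ∀ f : I.obj ⟶ iS.obj W, f = 0)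
    (hJ : ∀ W : D, W ∈ heartSet D tD → ∀ f : iS.obj W ⟶ J.obj, f = 0) :
    Function.Bijective (fun φ : I ⟶ J => jU.map ((heartIncl C tC).map φ)) := by
  have hP0 : tD.le 0 (iU.obj I.obj) := ((hglued _).1.1 I.property.1).2
  have hQ0 : tD.ge 0 (iE.obj J.obj) := ((hglued _).2.1 J.property.2).2
  have hP : ∀ W : D, W ∈ heartSet D tD → ∀ f : iU.obj I.obj ⟶ W, f = 0 := by
    intro W hW f
    apply (adj₁.homEquiv _ _).injective
    rw [hI W hW (adj₁.homEquiv _ _ f), hI W hW (adj₁.homEquiv _ _ 0)]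
  have hQ : ∀ W : D, W ∈ heartSet D tD → ∀ f : W ⟶ iE.obj J.obj, f = 0 := by
    intro W hW f
    apply (adj₂.homEquiv _ _).symm.injective
    rw [hJ W hW ((adj₂.homEquiv _ _).symm f), hJ W hW ((adj₂.homEquiv _ _).symm 0)]
  have z0 : ∀ f : I.obj ⟶ iS.obj (iE.obj J.obj), f = 0 := by
    intro f
    apply (adj₁.homEquiv _ _).symm.injective
    rw [aux_hom_ge_zero tD hP0 hP hQ0 ((adj₁.homEquiv _ _).symm f),
      aux_hom_ge_zero tD hP0 hP hQ0 ((adj₁.homEquiv _ _).symm 0)]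
  have z1 : ∀ f : I.obj ⟶ (iS.obj (iE.obj J.obj))⟦(1 : ℤ)⟧, f = 0 := by
    intro f
    let c := (iS.commShiftIso (1 : ℤ)).app (iE.obj J.obj)
    have : f ≫ c.inv = 0 ≫ c.inv := by
      apply (adj₁.homEquiv _ _).symm.injective
      exact (aux_hom_shift_zero tD hP0 hP hQ0 hQ _).trans
        (aux_hom_shift_zero tD hP0 hP hQ0 hQ _).symm
    exact (cancel_mono c.inv).1 this
  obtain ⟨δ, hT⟩ := hg.tri₂ J.obj
  constructor
  · intro a b hab
    change jU.map a.hom = jU.map b.hom at hab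
    ext
    rw [← sub_eq_zero]
    have h1 : (a.hom - b.hom) ≫ adj₄.unit.app J.obj = 0 := by
      rw [Preadditive.sub_comp, sub_eq_zero]
      have na := adj₄.unit.naturality a.hom
      have nb := adj₄.unit.naturality b.hom
      dsimp at na nb
      rw [na, nb, hab]
    obtain ⟨w, hw⟩ := Triangle.coyoneda_exact₂ _ hT (a.hom - b.hom) h1
    rw [hw, z0 w]
    exact zero_comp
  · intro ψ
    obtain ⟨w, hw⟩ : ∃ w : I.obj ⟶ J.obj, adj₄.homEquiv I.obj (jU.obj J.obj) ψ =
        w ≫ adj₄.unit.app J.obj :=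
      Triangle.coyoneda_exact₃ _ hT (adj₄.homEquiv _ _ ψ) (z1 _)
    refine ⟨ObjectProperty.homMk w, ?_⟩
    change jU.map w = ψ
    have n := adj₄.unit.naturality w
    dsimp at n
    apply (adj₄.homEquiv _ _).injective
    rw [adj₄.homEquiv_unit]
    exact n.symm.trans hw.symm

end Helpers

/-- Given gluing data endowed with compatible t-structures,
for any `X', Y'` in the heart of `t_E` one has `j^*(j_{!*}X') ≅ X'`, and the
map `Hom_C(j_{!*}X', j_{!*}Y') → Hom_E(X', Y')` induced by `j^*` (via these
isomorphisms) is bijective, i.e. `j_{!*}` is fully faithful. -/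
theorem statement18
    (iS : D ⥤ C) (jU : C ⥤ E) (iU iE : C ⥤ D) (jL jR : E ⥤ C)
    [iS.CommShift ℤ] [jU.CommShift ℤ] [iU.CommShift ℤ] [iE.CommShift ℤ]
    [jL.CommShift ℤ] [jR.CommShift ℤ]
    [iS.IsTriangulated] [jU.IsTriangulated] [iU.IsTriangulated]
    [iE.IsTriangulated] [jL.IsTriangulated] [jR.IsTriangulated]
    (adj₁ : iU ⊣ iS) (adj₂ : iS ⊣ iE) (adj₃ : jL ⊣ jU) (adj₄ : jU ⊣ jR)
    (hg : GluingCond iS jU iU iE jL jR adj₁ adj₂ adj₃ adj₄)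
    (tC : TStructure C) (tD : TStructure D) (tE : TStructure E)
    (hglued : GluedTS jU iU iE tC tD tE)
    (τC : TruncData C tC) [HasImages (THeart C tC)]
    (X' Y' : THeart E tE) :
    Nonempty (jU.obj ((jMiddle jU jL jR adj₃ adj₄ hg.iso₃ τC X').obj) ≅ X'.obj) ∧
    Nonempty (jU.obj ((jMiddle jU jL jR adj₃ adj₄ hg.iso₃ τC Y').obj) ≅ Y'.obj) ∧
    Function.Bijective
      (fun φ : (jMiddle jU jL jR adj₃ adj₄ hg.iso₃ τC X' ⟶
          jMiddle jU jL jR adj₃ adj₄ hg.iso₃ τC Y') =>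
        jU.map ((heartIncl C tC).map φ)) := by
  have hu : ∀ Z : THeart E tE, IsIso (jU.map ((adj₄.homEquiv (jL.obj Z.obj) Z.obj)
      (haveI := hg.iso₃ Z.obj; inv (adj₃.unit.app Z.obj)))) := by
    intro Z
    haveI := hg.iso₃ Z.obj
    haveI := hg.iso₄ Z.obj
    have h := (adj₄.homEquiv (jL.obj Z.obj) Z.obj).symm_apply_apply (inv (adj₃.unit.app Z.obj))
    rw [adj₄.homEquiv_counit] at h
    haveI : IsIso (jU.map ((adj₄.homEquiv (jL.obj Z.obj) Z.obj) (inv (adj₃.unit.app Z.obj))) ≫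
        adj₄.counit.app Z.obj) := by
      rw [h]
      infer_instance
    exact IsIso.of_isIso_comp_right _ (adj₄.counit.app Z.obj)
  have hX := aux_middle hg hglued τC X' _ (hu X')
  have hY := aux_middle hg hglued τC Y' _ (hu Y')
  exact ⟨hX.1, hY.1, aux_full hg hglued _ _ hX.2.1 hY.2.2⟩

end PaperGluing
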